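/- (Generalized Yakubovich Lemma of Iwasaki and Hara.) Let M, N ∈ ℂ^{n×n_z} with n_z > n, let G ∈ HM_{n_z}, and let Θ₁, Θ₂ be 2×2 Hermitian matrices with det Θ₁ < 0 and det Θ₂ < 0. Suppose the intersection Γ_{Θ₁} ∩ Ω_{Θ₂} contains more than one point, i.e., there exist two nonzero pairs (α₁, β₁), (α₂, β₂) ∈ ℂ², neither a complex scalar multiple of the other, each satisfying (α, β)Θ₁(α, β)* = 0 and (α, β)Θ₂(α, β)* ≥ 0. Then the following are equivalent: (1) for every nonzero pair (α, β) ∈ ℂ² with (α, β)Θ₁(α, β)* = 0 and (α, β)Θ₂(α, β)* ≥ 0, and every nonzero z ∈ ℂ^{n_z} with (αN − βM)z = 0, one has z*Gz > 0; (2) there exist H₁, H₂ ∈ HM_n with H₂ ≻ 0 such that G ≻ Λ'_{M,N,Θ₁}(H₁) + Λ'_{M,N,Θ₂}(H₂). -/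

import Mathlib

open Matrix ComplexOrder

/-- The value `(α, β) Θ (α, β)*` of the Hermitian form defined by a `2 × 2` Hermitian
matrix `Θ` on the row vector `(α, β)`; its vanishing (resp. nonnegativity) describes the
curve `Γ_Θ` (resp. the region `Ω_Θ`) on the extended complex plane in homogeneous
coordinates. -/
noncomputable def hermPairVal (Θ : Matrix (Fin 2) (Fin 2) ℂ) (α β : ℂ) : ℂ :=
  ![α, β] ⬝ᵥ Θ *ᵥ star ![α, β]

/-- The adjoint generalized Lyapunov operator
`Λ'_{M,N,Θ}(H) = θ₁₁ M*HM + θ₂₁ M*HN + θ₁₂ N*HM + θ₂₂ N*HN`. -/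
noncomputable def lyapAdj {k z : Type*} [Fintype k] (M N : Matrix k z ℂ)
    (Θ : Matrix (Fin 2) (Fin 2) ℂ) (H : Matrix k k ℂ) : Matrix z z ℂ :=
  Θ 0 0 • (Mᴴ * H * M) + Θ 1 0 • (Mᴴ * H * N) + Θ 0 1 • (Nᴴ * H * M) + Θ 1 1 • (Nᴴ * H * N)

/-- The matrix of the orthogonal projection onto the orthogonal complement of `u`. -/
noncomputable def orthProjCompl {m : Type*} [Fintype m] [DecidableEq m] (u : m → ℂ) :
    Matrix m m ℂ :=
  1 - (star u ⬝ᵥ u)⁻¹ • vecMulVec u (star u)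

lemma star_inv_star_dotProduct_self {m : Type*} [Fintype m] (u : m → ℂ) :
    star (star u ⬝ᵥ u)⁻¹ = (star u ⬝ᵥ u)⁻¹ := by
  rw [star_inv₀, ← star_dotProduct]

lemma orthProjCompl_conjTranspose {m : Type*} [Fintype m] [DecidableEq m] (u : m → ℂ) :
    (orthProjCompl u)ᴴ = orthProjCompl u := by
  simp only [orthProjCompl, conjTranspose_sub, conjTranspose_one, conjTranspose_smul,
    conjTranspose_vecMulVec, star_star, star_inv_star_dotProduct_self]

lemma orthProjCompl_mulVec {m : Type*} [Fintype m] [DecidableEq m] (u v : m → ℂ) :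
    orthProjCompl u *ᵥ v = v - ((star u ⬝ᵥ u)⁻¹ * (star u ⬝ᵥ v)) • u := by
  simp [orthProjCompl, sub_mulVec, smul_mulVec, vecMulVec_mulVec, smul_smul]

lemma orthProjCompl_mulVec_self {m : Type*} [Fintype m] [DecidableEq m] {u : m → ℂ} (hu : u ≠ 0) :
    orthProjCompl u *ᵥ u = 0 := by
  have h : star u ⬝ᵥ u ≠ 0 := fun h => hu (dotProduct_star_self_eq_zero.1 h)
  rw [orthProjCompl_mulVec, inv_mul_cancel₀ h, one_smul, sub_self]

lemma orthProjCompl_mul_self {m : Type*} [Fintype m] [DecidableEq m] {u : m → ℂ} (hu : u ≠ 0) :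
    orthProjCompl u * orthProjCompl u = orthProjCompl u := by
  nth_rw 2 [orthProjCompl]
  rw [Matrix.mul_sub, Matrix.mul_one, Matrix.mul_smul, mul_vecMulVec, orthProjCompl_mulVec_self hu]
  ext i j
  simp [vecMulVec]

/-- If the range of `Aᴴ` is contained in that of `Bᴴ ≠ 0`, the pencil of `Aᴴ` and `Bᴴ` has an
eigenvector outside the kernel of `Bᴴ`. -/
lemma exists_conjTranspose_pencil_eigenvector {k m : Type*} [Fintype k] [DecidableEq k]
    (A B : Matrix k m ℂ)
    (hle : A.conjTranspose.mulVecLin.range ≤ B.conjTranspose.mulVecLin.range)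
    (hne : Bᴴ ≠ 0) :
    ∃ (x : k → ℂ) (μ : ℂ), Aᴴ *ᵥ x = μ • Bᴴ *ᵥ x ∧ Bᴴ *ᵥ x ≠ 0 := by
  set W := B.conjTranspose.mulVecLin.range with hW
  obtain ⟨s, hs⟩ := LinearMap.exists_rightInverse_of_surjective
    B.conjTranspose.mulVecLin.rangeRestrict (LinearMap.range_rangeRestrict _)
  have hnt : Nontrivial W := by
    rw [Submodule.nontrivial_iff_ne_bot, hW, Ne, LinearMap.range_eq_bot]
    intro h
    refine hne (Matrix.toLin'.injective ?_)
    rw [map_zero]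
    exact h
  let T : Module.End ℂ W :=
    (A.conjTranspose.mulVecLin ∘ₗ s).codRestrict W fun w => hle ⟨s w, rfl⟩
  obtain ⟨μ, hμ⟩ := Module.End.exists_eigenvalue T
  obtain ⟨w, hw⟩ := hμ.exists_hasEigenvector
  have hsw : Bᴴ *ᵥ s w = w := congrArg Subtype.val (LinearMap.congr_fun hs w)
  refine ⟨s w, μ, ?_, ?_⟩
  · rw [hsw]
    exact congrArg Subtype.val hw.apply_eq_smul
  · rw [hsw]
    exact fun h => hw.2 (Subtype.ext h)

lemma range_mulVecLin_self_mul_conjTranspose {k m : Type*} [Fintype k] [Fintype m]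
    (B : Matrix k m ℂ) :
    (B * Bᴴ).mulVecLin.range = B.mulVecLin.range := by
  refine Submodule.eq_of_le_of_finrank_eq ?_ (rank_self_mul_conjTranspose B)
  rw [mulVecLin_mul]
  exact LinearMap.range_comp_le_range _ _

/-- One direction can be split off a factorisation `A * Bᴴ` of a Hermitian (resp. positive
semidefinite) matrix so that the remainder keeps this property. -/
lemma exists_deflating_direction {k m : Type*} [Fintype k] [DecidableEq k] [Fintype m]
    [DecidableEq m] (pos : Prop) (A B : Matrix k m ℂ) (W : Submodule ℂ (m → ℂ))
    (hA : ∀ x, Aᴴ *ᵥ x ∈ W) (hB : ∀ x, Bᴴ *ᵥ x ∈ W) (hW : W ≠ ⊥)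
    (hherm : (A * Bᴴ).IsHermitian) (hpos : pos → (A * Bᴴ).PosSemidef) :
    ∃ u ∈ W, u ≠ 0 ∧
      (∃ s t : ℝ, ¬(s = 0 ∧ t = 0) ∧ (pos → 0 ≤ s * t) ∧
        (s : ℂ) • B *ᵥ u = (t : ℂ) • A *ᵥ u) ∧
      (A * orthProjCompl u * Bᴴ).IsHermitian ∧
      (pos → (A * orthProjCompl u * Bᴴ).PosSemidef) := by
  by_cases hker : ∃ u ∈ W, u ≠ 0 ∧ B *ᵥ u = 0
  · obtain ⟨u, huW, hu, hBu⟩ := hker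
    have hQ : orthProjCompl u * Bᴴ = Bᴴ := by
      rw [orthProjCompl, Matrix.sub_mul, Matrix.smul_mul, vecMulVec_mul, ← star_mulVec, hBu]
      ext i j
      simp [vecMulVec]
    refine ⟨u, huW, hu, ⟨1, 0, by simp, by simp, by simp [hBu]⟩, ?_⟩
    rw [Matrix.mul_assoc, hQ]
    exact ⟨hherm, hpos⟩
  · push Not at hker
    have hBW : ∀ u ∈ W, B *ᵥ u = 0 → u = 0 := fun u hu h => by
      by_contra hne
      exact hker u hu hne h
    have hle : A.conjTranspose.mulVecLin.range ≤ B.conjTranspose.mulVecLin.range := by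
      rintro _ ⟨x, rfl⟩
      have hx : B *ᵥ (Aᴴ *ᵥ x) ∈ (B * Bᴴ).mulVecLin.range := by
        rw [range_mulVecLin_self_mul_conjTranspose]
        exact ⟨_, rfl⟩
      obtain ⟨w, hw⟩ := hx
      refine ⟨w, ?_⟩
      have := hBW (Aᴴ *ᵥ x - Bᴴ *ᵥ w) (W.sub_mem (hA x) (hB w)) (by
        rw [mulVec_sub, ← hw, mulVecLin_apply, mulVec_mulVec, sub_self])
      exact (sub_eq_zero.1 this).symm
    have hne : Bᴴ ≠ 0 := by
      intro h
      obtain ⟨u, hu, hu0⟩ := W.ne_bot_iff.1 hW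
      rw [conjTranspose_eq_zero] at h
      exact hu0 (hBW u hu (by rw [h, zero_mulVec]))
    obtain ⟨x, μ, hx, hx0⟩ := exists_conjTranspose_pencil_eigenvector A B hle hne
    set u := Bᴴ *ᵥ x with hu
    have hswap : A * Bᴴ = B * Aᴴ := by
      simpa using hherm.symm
    have huu : star u ⬝ᵥ u ≠ 0 := fun h => hx0 (dotProduct_star_self_eq_zero.1 h)
    have huu' : 0 < star u ⬝ᵥ u := dotProduct_star_self_pos_iff.2 hx0
    have hquad : star x ⬝ᵥ (A * Bᴴ) *ᵥ x = μ * (star u ⬝ᵥ u) := by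
      rw [hswap, ← mulVec_mulVec, hx, mulVec_smul, dotProduct_smul, dotProduct_mulVec, hu,
        star_mulVec, conjTranspose_conjTranspose, smul_eq_mul]
    have hre : ((star u ⬝ᵥ u).re : ℂ) = star u ⬝ᵥ u := by
      apply Complex.ext <;> simp [(Complex.pos_iff.1 huu').2]
    have huu_re : 0 < (star u ⬝ᵥ u).re := (Complex.pos_iff.1 huu').1
    have hμim : μ.im = 0 := by
      have h := hherm.im_star_dotProduct_mulVec_self x
      rw [hquad, ← hre] at h
      simpa [huu_re.ne'] using h
    have hμ : (μ.re : ℂ) = μ := by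
      apply Complex.ext <;> simp [hμim]
    have hμpos : pos → 0 ≤ μ.re := fun hp => by
      have h := (Complex.nonneg_iff.1 ((hpos hp).dotProduct_mulVec_nonneg x)).1
      rw [hquad, ← hre, ← hμ, ← Complex.ofReal_mul, Complex.ofReal_re] at h
      exact nonneg_of_mul_nonneg_left h huu_re
    have hAu : A *ᵥ u = μ • B *ᵥ u := by
      rw [hu, mulVec_mulVec, hswap, ← mulVec_mulVec, hx, mulVec_smul]
    let P : Matrix k k ℂ := 1 - (star u ⬝ᵥ u)⁻¹ • vecMulVec x (star (B *ᵥ u))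
    have hBP : Bᴴ * P = orthProjCompl u * Bᴴ := by
      rw [orthProjCompl, Matrix.mul_sub, Matrix.sub_mul, Matrix.mul_one, Matrix.one_mul,
        Matrix.mul_smul, Matrix.smul_mul, mul_vecMulVec, vecMulVec_mul, ← hu,
        ← conjTranspose_conjTranspose B, ← star_mulVec,
        conjTranspose_conjTranspose]
    have hPA : Pᴴ * A = A * orthProjCompl u := by
      have h1 : star x ᵥ* A = μ • star u := by
        have := congrArg star hx
        rw [star_mulVec, conjTranspose_conjTranspose, star_smul, ← hμ] at this
        rw [this, ← hμ]
        simp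
      rw [orthProjCompl, conjTranspose_sub, conjTranspose_one, conjTranspose_smul,
        star_inv_star_dotProduct_self, conjTranspose_vecMulVec, star_star, Matrix.mul_sub,
          Matrix.sub_mul,
        Matrix.mul_one, Matrix.one_mul, Matrix.mul_smul, Matrix.smul_mul, mul_vecMulVec,
        vecMulVec_mul, h1, hAu]
      ext i j
      simp only [Matrix.sub_apply, Matrix.smul_apply, vecMulVec_apply, Pi.smul_apply, smul_eq_mul]
      ring
    have hcongr : A * orthProjCompl u * Bᴴ = Pᴴ * (A * Bᴴ) * P := by
      rw [← Matrix.mul_assoc, hPA, Matrix.mul_assoc _ Bᴴ P, hBP, ← Matrix.mul_assoc,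
        Matrix.mul_assoc A _ (orthProjCompl u), orthProjCompl_mul_self hx0]
    refine ⟨u, hB x, hx0, ⟨μ.re, 1, by simp, by simpa using hμpos, ?_⟩, ?_⟩
    · rw [hμ, hAu]
      simp
    · rw [hcongr]
      exact ⟨isHermitian_conjTranspose_mul_mul P hherm,
        fun hp => (hpos hp).conjTranspose_mul_mul_same P⟩

lemma rank_mul_orthProjCompl_lt {m : Type*} [Fintype m] [DecidableEq m] (Z : Matrix m m ℂ)
    (w : m → ℂ) (hw : Zᴴ *ᵥ w ≠ 0) :
    (Z * orthProjCompl (Zᴴ *ᵥ w)).rank < Z.rank := by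
  set u := Zᴴ *ᵥ w with hu
  have hker : Z.mulVecLin.ker < (Z * orthProjCompl u).mulVecLin.ker := by
    refine lt_of_le_of_ne (fun v hv => ?_) fun h => ?_
    · rw [LinearMap.mem_ker, mulVecLin_apply] at hv ⊢
      have : star u ⬝ᵥ v = 0 := by
        rw [hu, star_mulVec, conjTranspose_conjTranspose, ← dotProduct_mulVec, hv,
          dotProduct_zero]
      rw [← mulVec_mulVec, orthProjCompl_mulVec, this, mul_zero, zero_smul, sub_zero, hv]
    · have h1 : u ∈ (Z * orthProjCompl u).mulVecLin.ker := by
        rw [LinearMap.mem_ker, mulVecLin_apply, ← mulVec_mulVec, orthProjCompl_mulVec_self hw,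
          mulVec_zero]
      rw [← h, LinearMap.mem_ker, mulVecLin_apply] at h1
      apply hw
      have h2 : star u ⬝ᵥ u = 0 := by
        nth_rw 1 [hu]
        rw [star_mulVec, conjTranspose_conjTranspose, ← dotProduct_mulVec, h1, dotProduct_zero]
      exact dotProduct_star_self_eq_zero.1 h2
  have h1 := Submodule.finrank_lt_finrank_of_lt hker
  have h2 := LinearMap.finrank_range_add_finrank_ker Z.mulVecLin
  have h3 := LinearMap.finrank_range_add_finrank_ker (Z * orthProjCompl u).mulVecLin
  rw [Matrix.rank, Matrix.rank]
  omega

/-- If `G` is positive on all directions `z` with `s • R z = t • S z` for real `(s, t) ≠ 0` (with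
`0 ≤ s * t` if `pos`), then it has positive trace against each nonzero `Z * Zᴴ` for which
`S * (Z * Zᴴ) * Rᴴ` is Hermitian (and positive semidefinite if `pos`). -/
lemma trace_pos_of_pencil {k m : Type*} [Fintype k] [DecidableEq k] [Fintype m] [DecidableEq m]
    (pos : Prop) (S R : Matrix k m ℂ) (G : Matrix m m ℂ)
    (hG : ∀ s t : ℝ, ¬(s = 0 ∧ t = 0) → (pos → 0 ≤ s * t) → ∀ z : m → ℂ, z ≠ 0 →
      (s : ℂ) • R *ᵥ z = (t : ℂ) • S *ᵥ z → 0 < (star z ⬝ᵥ G *ᵥ z).re)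
    (Z : Matrix m m ℂ) (hZ : Z ≠ 0) (hherm : (S * Z * (R * Z)ᴴ).IsHermitian)
    (hpos : pos → (S * Z * (R * Z)ᴴ).PosSemidef) :
    0 < (Zᴴ * G * Z).trace.re := by
  induction hr : Z.rank using Nat.strong_induction_on generalizing Z with
  | _ r ih =>
    obtain ⟨u, ⟨w, hw⟩, hu, ⟨s, t, hst, hst', hsu⟩, hherm', hpos'⟩ :=
      exists_deflating_direction pos (S * Z) (R * Z) Z.conjTranspose.mulVecLin.range
        (fun x => ⟨Sᴴ *ᵥ x, by simp [conjTranspose_mul, mulVec_mulVec]⟩)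
        (fun x => ⟨Rᴴ *ᵥ x, by simp [conjTranspose_mul, mulVec_mulVec]⟩)
        (fun h => hZ (by
          rw [LinearMap.range_eq_bot] at h
          rw [← conjTranspose_eq_zero]
          refine Matrix.toLin'.injective ?_
          rw [map_zero]
          exact h)) hherm hpos
    rw [mulVecLin_apply] at hw
    have hzu : Z *ᵥ u ≠ 0 := fun h => hu (by
      have h2 : star u ⬝ᵥ u = 0 := by
        nth_rw 1 [← hw]
        rw [star_mulVec, conjTranspose_conjTranspose, ← dotProduct_mulVec, h, dotProduct_zero]
      exact dotProduct_star_self_eq_zero.1 h2)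
    have hz := hG s t hst hst' (Z *ᵥ u) hzu (by simpa [mulVec_mulVec] using hsu)
    have huu : 0 < star u ⬝ᵥ u := dotProduct_star_self_pos_iff.2 hu
    have hre : ((star u ⬝ᵥ u).re : ℂ) = star u ⬝ᵥ u := by
      apply Complex.ext <;> simp [(Complex.pos_iff.1 huu).2]
    have huu_re : 0 < (star u ⬝ᵥ u).re := (Complex.pos_iff.1 huu).1
    have hsplit : (Zᴴ * G * Z).trace = ((Z * orthProjCompl u)ᴴ * G * (Z * orthProjCompl u)).trace
        + (((star u ⬝ᵥ u).re⁻¹ : ℝ) : ℂ) * (star (Z *ᵥ u) ⬝ᵥ G *ᵥ (Z *ᵥ u)) := by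
      have h1 : ((Z * orthProjCompl u)ᴴ * G * (Z * orthProjCompl u)).trace =
          (Zᴴ * G * Z * orthProjCompl u).trace := by
        rw [conjTranspose_mul, orthProjCompl_conjTranspose, Matrix.mul_assoc, Matrix.mul_assoc,
          Matrix.trace_mul_comm]
        simp only [Matrix.mul_assoc, orthProjCompl_mul_self hu]
      rw [h1, orthProjCompl, Matrix.mul_sub, Matrix.mul_one, trace_sub, Matrix.mul_smul,
        mul_vecMulVec, trace_smul,
        trace_vecMulVec, Complex.ofReal_inv, hre, star_mulVec, ← dotProduct_mulVec,
        mulVec_mulVec, mulVec_mulVec, dotProduct_comm (star u), smul_eq_mul]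
      simp only [Matrix.mul_assoc]
      rw [dotProduct_comm (star u)]
      ring
    rw [hsplit, Complex.add_re, Complex.re_ofReal_mul]
    refine add_pos_of_nonneg_of_pos ?_ (mul_pos (inv_pos.2 huu_re) hz)
    by_cases hZ' : Z * orthProjCompl u = 0
    · simp [hZ']
    have hfac : S * (Z * orthProjCompl u) * (R * (Z * orthProjCompl u))ᴴ =
        S * Z * orthProjCompl u * (R * Z)ᴴ := by
      rw [← Matrix.mul_assoc R, conjTranspose_mul (R * Z), orthProjCompl_conjTranspose]
      rw [← Matrix.mul_assoc, ← Matrix.mul_assoc, Matrix.mul_assoc (S * Z),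
        orthProjCompl_mul_self hu]
    refine (ih _ ?_ (Z * orthProjCompl u) hZ' ?_ ?_ rfl).le
    · rw [← hr, ← hw]
      exact rank_mul_orthProjCompl_lt Z w (by rwa [hw])
    · rwa [hfac]
    · rwa [hfac]

/-- A real binary quadratic form of positive discriminant is a product
of two independent real linear forms. -/
lemma exists_linear_factors {a d e : ℝ} (h : a * d < e ^ 2) :
    ∃ p q r w : ℝ, p * w - q * r ≠ 0 ∧ p * r = a ∧ q * w = d ∧ p * w + q * r = 2 * e := by
  have hD : 0 < √(e ^ 2 - a * d) := Real.sqrt_pos.2 (by linarith)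
  have hsq : √(e ^ 2 - a * d) ^ 2 = e ^ 2 - a * d := Real.sq_sqrt (by linarith)
  set D := √(e ^ 2 - a * d)
  obtain ⟨σ, hσ, hk⟩ : ∃ σ : ℝ, σ ^ 2 = D ^ 2 ∧ e + σ ≠ 0 := by
    by_cases he : e + D = 0
    · exact ⟨-D, by ring, by intro h'; linarith⟩
    · exact ⟨D, rfl, he⟩
  have hσ0 : σ ≠ 0 := by
    rintro rfl
    nlinarith
  have had : a * d = (e - σ) * (e + σ) := by linear_combination hsq + hσ
  refine ⟨a / (e + σ), 1, e + σ, d, ?_, by field_simp, by ring, ?_⟩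
  · rw [div_mul_eq_mul_div, had, mul_div_cancel_right₀ _ hk]
    intro h'
    exact hσ0 (by linarith)
  · rw [div_mul_eq_mul_div, had, mul_div_cancel_right₀ _ hk]
    ring

/-- Simultaneous normal form for a curve `Γ_{Θ₁}` and a region `Ω_{Θ₂}` meeting in two points. -/
def IsNormalPair (pos : Prop) (κ : ℝ) (Θ₁ Θ₂ : Matrix (Fin 2) (Fin 2) ℂ) : Prop :=
  κ ≠ 0 ∧ Θ₁ = !![0, κ * Complex.I; -(κ * Complex.I), 0] ∧
    ∃ (a d : ℝ) (b : ℂ), Θ₂ = !![(a : ℂ), b; star b, (d : ℂ)] ∧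
      ((¬pos ∧ 0 ≤ a ∧ 0 ≤ d ∧ b.re ^ 2 ≤ a * d) ∨ (pos ∧ a = 0 ∧ d = 0 ∧ 0 < b.re))

lemma hermPairVal_eq (Θ : Matrix (Fin 2) (Fin 2) ℂ) (α β : ℂ) :
    hermPairVal Θ α β = α * Θ 0 0 * star α + α * Θ 0 1 * star β + β * Θ 1 0 * star α +
      β * Θ 1 1 * star β := by
  simp [hermPairVal, Matrix.mulVec, dotProduct, Fin.sum_univ_two]
  ring

lemma hermPairVal_congr (T Θ : Matrix (Fin 2) (Fin 2) ℂ) (s t : ℂ) :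
    hermPairVal (T * Θ * Tᴴ) s t =
      hermPairVal Θ (s * T 0 0 + t * T 1 0) (s * T 0 1 + t * T 1 1) := by
  simp [hermPairVal_eq, Matrix.mul_apply, Fin.sum_univ_two]
  ring

lemma hermPairVal_re_eq (Θ : Matrix (Fin 2) (Fin 2) ℂ) (hΘ : Θ.IsHermitian) (α β : ℂ) :
    ((hermPairVal Θ α β).re : ℂ) = hermPairVal Θ α β := by
  rw [← Complex.conj_eq_iff_re, hermPairVal_eq]
  have h00 := hΘ.apply 0 0
  have h01 := hΘ.apply 0 1
  have h10 := hΘ.apply 1 0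
  have h11 := hΘ.apply 1 1
  simp only [RCLike.star_def] at *
  simp only [map_add, map_mul, Complex.conj_conj, h00, h01, h10, h11]
  ring

lemma exists_isNormalPair {Θ₁ Θ₂ : Matrix (Fin 2) (Fin 2) ℂ}
    (hΘ₁herm : Θ₁.IsHermitian) (hΘ₂herm : Θ₂.IsHermitian) (hΘ₁det : Θ₁.det ≠ 0)
    {α₁ β₁ α₂ β₂ : ℂ} (hind : α₁ * β₂ - β₁ * α₂ ≠ 0)
    (h₁₁ : hermPairVal Θ₁ α₁ β₁ = 0) (h₂₁ : 0 ≤ (hermPairVal Θ₂ α₁ β₁).re)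
    (h₁₂ : hermPairVal Θ₁ α₂ β₂ = 0) (h₂₂ : 0 ≤ (hermPairVal Θ₂ α₂ β₂).re) :
    ∃ (T : Matrix (Fin 2) (Fin 2) ℂ) (pos : Prop) (κ : ℝ), T.det ≠ 0 ∧
      IsNormalPair pos κ (T * Θ₁ * Tᴴ) (T * Θ₂ * Tᴴ) := by
  let T₀ : Matrix (Fin 2) (Fin 2) ℂ := !![α₁, β₁; α₂, β₂]
  have hT₀ : T₀.det ≠ 0 := by simpa [T₀, det_fin_two] using hind
  have hdiag : ∀ Θ : Matrix (Fin 2) (Fin 2) ℂ, (T₀ * Θ * T₀ᴴ) 0 0 = hermPairVal Θ α₁ β₁ ∧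
      (T₀ * Θ * T₀ᴴ) 1 1 = hermPairVal Θ α₂ β₂ := by
    intro Θ
    simp only [hermPairVal_eq, Matrix.mul_apply, Fin.sum_univ_two, conjTranspose_apply]
    constructor <;> simp [T₀] <;> ring
  have hherm : ∀ (T Θ : Matrix (Fin 2) (Fin 2) ℂ), Θ.IsHermitian → (T * Θ * Tᴴ).IsHermitian :=
    fun T Θ hΘ => isHermitian_mul_mul_conjTranspose T hΘ
  set c := (T₀ * Θ₁ * T₀ᴴ) 0 1 with hc
  have hc' : (T₀ * Θ₁ * T₀ᴴ) 1 0 = star c := ((hherm T₀ Θ₁ hΘ₁herm).apply 1 0).symm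
  have hform : T₀ * Θ₁ * T₀ᴴ = !![0, c; star c, 0] := by
    rw [eta_fin_two (T₀ * Θ₁ * T₀ᴴ), (hdiag Θ₁).1, (hdiag Θ₁).2, h₁₁, h₁₂, hc']
  have hc0 : c ≠ 0 := by
    intro h
    have h1 : (T₀ * Θ₁ * T₀ᴴ).det = 0 := by rw [hform, h]; simp
    rw [det_mul, det_mul, det_conjTranspose] at h1
    simp [hT₀, hΘ₁det] at h1
  let T₁ : Matrix (Fin 2) (Fin 2) ℂ := !![1, 0; 0, -Complex.I / star c]
  have hsc : star c ≠ 0 := star_ne_zero.2 hc0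
  have hT₁ : T₁.det ≠ 0 := by simp [T₁, det_fin_two, hc0]
  have hform₁ : (T₁ * T₀) * Θ₁ * (T₁ * T₀)ᴴ = !![0, Complex.I; -Complex.I, 0] := by
    have : (T₁ * T₀) * Θ₁ * (T₁ * T₀)ᴴ = T₁ * (T₀ * Θ₁ * T₀ᴴ) * T₁ᴴ := by
      simp only [conjTranspose_mul, Matrix.mul_assoc]
    rw [this, hform]
    have h1 : c * (Complex.I / c) = Complex.I := by field_simp
    have h2 : -Complex.I / star c * star c = -Complex.I := by field_simp
    ext i j
    fin_cases i <;> fin_cases j <;> simp [T₁, Matrix.mul_apply, Fin.sum_univ_two]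
    · exact h1
    · exact h2
  set Φ := (T₁ * T₀) * Θ₂ * (T₁ * T₀)ᴴ with hΦ
  have hΦherm : Φ.IsHermitian := hherm _ _ hΘ₂herm
  have hΦeq : Φ = T₁ * (T₀ * Θ₂ * T₀ᴴ) * T₁ᴴ := by
    simp only [hΦ, conjTranspose_mul, Matrix.mul_assoc]
  have hΦ00 : Φ 0 0 = ((hermPairVal Θ₂ α₁ β₁).re : ℂ) := by
    rw [hermPairVal_re_eq _ hΘ₂herm, ← (hdiag Θ₂).1, hΦeq]
    generalize T₀ * Θ₂ * T₀ᴴ = X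
    simp only [Matrix.mul_apply, Fin.sum_univ_two, conjTranspose_apply]
    simp [T₁]
  have hΦ11 : Φ 1 1 = ((Complex.normSq (-Complex.I / star c) *
      (hermPairVal Θ₂ α₂ β₂).re : ℝ) : ℂ) := by
    rw [Complex.ofReal_mul, hermPairVal_re_eq _ hΘ₂herm, ← (hdiag Θ₂).2, hΦeq,
      ← Complex.mul_conj]
    generalize T₀ * Θ₂ * T₀ᴴ = X
    simp only [Matrix.mul_apply, Fin.sum_univ_two, conjTranspose_apply]
    simp [T₁]
    ring
  have hΦ10 : Φ 1 0 = star (Φ 0 1) := (hΦherm.apply 1 0).symm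
  set a := (hermPairVal Θ₂ α₁ β₁).re
  set d := Complex.normSq (-Complex.I / star c) * (hermPairVal Θ₂ α₂ β₂).re
  have hd : 0 ≤ d := mul_nonneg (Complex.normSq_nonneg _) h₂₂
  have hdet : (T₁ * T₀).det ≠ 0 := by rw [det_mul]; exact mul_ne_zero hT₁ hT₀
  have hform₂ : Φ = !![(a : ℂ), Φ 0 1; star (Φ 0 1), (d : ℂ)] := by
    conv_lhs => rw [eta_fin_two Φ, hΦ00, hΦ11, hΦ10]
  set b := Φ 0 1
  rcases le_or_gt (b.re ^ 2) (a * d) with hle | hlt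
  · refine ⟨T₁ * T₀, False, 1, hdet, one_ne_zero, by rw [hform₁]; simp, a, d, b, hform₂,
      Or.inl ⟨id, h₂₁, hd, hle⟩⟩
  · obtain ⟨p, q, r, w, hpw, hpr, hqw, hsum⟩ := exists_linear_factors hlt
    -- The new coordinates are the two linear factors, so the change of basis is the inverse
    -- transpose of their coefficient matrix, up to the factor `p * w - q * r`.
    let T₂ : Matrix (Fin 2) (Fin 2) ℂ := !![(w : ℂ), -(r : ℂ); -(q : ℂ), (p : ℂ)]
    have hT₂ : T₂.det = ((p * w - q * r : ℝ) : ℂ) := by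
      simp [T₂, det_fin_two]
      ring
    have hassoc : ∀ Θ, (T₂ * (T₁ * T₀)) * Θ * (T₂ * (T₁ * T₀))ᴴ =
        T₂ * ((T₁ * T₀) * Θ * (T₁ * T₀)ᴴ) * T₂ᴴ := fun Θ => by
      simp only [conjTranspose_mul, Matrix.mul_assoc]
    have hprc : (p * r : ℂ) = a := by exact_mod_cast hpr
    have hqwc : (q * w : ℂ) = d := by exact_mod_cast hqw
    have hbb : star b = p * w + q * r - b := by
      have h1 : b + star b = ((2 * b.re : ℝ) : ℂ) := Complex.add_conj b
      rw [← hsum] at h1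
      push_cast at h1
      linear_combination h1
    refine ⟨T₂ * (T₁ * T₀), True, p * w - q * r, ?_, hpw, ?_, 0, 0,
      w * a * -q + w * b * p + r * star b * q - r * d * p, ?_,
      Or.inr ⟨trivial, rfl, rfl, ?_⟩⟩
    · rw [det_mul, hT₂]
      exact mul_ne_zero (Complex.ofReal_ne_zero.2 hpw) hdet
    · rw [hassoc, hform₁]
      ext i j
      fin_cases i <;> fin_cases j <;> simp [T₂, Matrix.mul_apply, Fin.sum_univ_two] <;> ring
    · rw [hassoc, ← hΦ, hform₂]
      ext i j
      fin_cases i <;> fin_cases j <;>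
        simp [T₂, Matrix.mul_apply, Fin.sum_univ_two, ← hprc, ← hqwc]
      all_goals try simp only [RCLike.star_def] at hbb
      all_goals try rw [hbb]
      all_goals ring
    · have h1 : (w * a * -q + w * b * p + r * star b * q - r * d * p : ℂ).re =
          (p * w - q * r) ^ 2 / 2 := by
        simp
        rw [← hpr, ← hqw]
        have : b.re = (p * w + q * r) / 2 := by linarith
        rw [this]
        ring
      rw [h1]
      positivity

lemma trace_mul_vecMulVec_star {k m : Type*} [Fintype k] [Fintype m] (X : Matrix m m ℂ)
    (A B : Matrix k m ℂ) (x : k → ℂ) :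
    (X * (Aᴴ * vecMulVec x (star x) * B)).trace = star x ⬝ᵥ (B * X * Aᴴ) *ᵥ x := by
  rw [mul_vecMulVec, vecMulVec_mul, mul_vecMulVec, trace_vecMulVec, dotProduct_comm,
    ← dotProduct_mulVec, mulVec_mulVec, mulVec_mulVec, Matrix.mul_assoc]

/-- The matrices with positive real quadratic form are open. -/
lemma isOpen_setOf_forall_re_dotProduct_mulVec_pos {m : Type*} [Fintype m] :
    IsOpen {Y : Matrix m m ℂ | ∀ x : m → ℂ, x ≠ 0 → 0 < (star x ⬝ᵥ Y *ᵥ x).re} := by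
  have hset : {Y : Matrix m m ℂ | ∀ x : m → ℂ, x ≠ 0 → 0 < (star x ⬝ᵥ Y *ᵥ x).re} =
      {Y | ∀ x ∈ Metric.sphere (0 : m → ℂ) 1, 0 < (star x ⬝ᵥ Y *ᵥ x).re} := by
    ext Y
    refine ⟨fun h x hx => h x (fun h0 => by simp [h0] at hx), fun h x hx => ?_⟩
    have hn : 0 < ‖x‖ := norm_pos_iff.2 hx
    have h1 := h ((‖x‖⁻¹ : ℂ) • x) (by simp [norm_smul, hn.ne'])
    have h2 : (star ((‖x‖⁻¹ : ℂ) • x) ⬝ᵥ Y *ᵥ ((‖x‖⁻¹ : ℂ) • x)) =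
        ((‖x‖⁻¹ * ‖x‖⁻¹ : ℝ) : ℂ) * (star x ⬝ᵥ Y *ᵥ x) := by
      simp [mulVec_smul, mul_assoc]
    rw [h2, Complex.re_ofReal_mul] at h1
    exact pos_of_mul_pos_right h1 (by positivity)
  rw [hset, isOpen_iff_eventually]
  intro Y hY
  refine (isCompact_sphere (0 : m → ℂ) 1).eventually_forall_of_forall_eventually fun x hx => ?_
  have hcont : Continuous fun p : Matrix m m ℂ × (m → ℂ) => (star p.2 ⬝ᵥ p.1 *ᵥ p.2).re := by
    fun_prop
  exact hcont.continuousAt.eventually_const_lt (hY x hx)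

/-- Every real functional on complex matrices is the real part of a trace pairing. -/
lemma exists_eq_re_trace_mul {m : Type*} [Fintype m] [DecidableEq m] (g : Matrix m m ℂ →ₗ[ℝ] ℝ) :
    ∃ X : Matrix m m ℂ, ∀ Y, g Y = (X * Y).trace.re := by
  refine ⟨Matrix.of fun j i : m => (g (Matrix.single i j (1 : ℂ)) : ℂ) -
    Complex.I * (g (Matrix.single i j Complex.I) : ℂ), fun Y => ?_⟩
  have hsingle : ∀ (i j : m) (y : ℂ), Matrix.single i j y =
      y.re • Matrix.single i j (1 : ℂ) + y.im • Matrix.single i j Complex.I := by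
    intro i j y
    rw [smul_single, smul_single, ← single_add]
    congr 1
    apply Complex.ext <;> simp
  conv_lhs => rw [matrix_eq_sum_single Y]
  simp only [map_sum, trace, diag, Matrix.mul_apply, Complex.re_sum]
  rw [Finset.sum_comm]
  refine Finset.sum_congr rfl fun j _ => Finset.sum_congr rfl fun i _ => ?_
  rw [hsingle, map_add, map_smul, map_smul]
  simp
  ring

/-- Theorem of alternatives for the strict linear matrix inequality `G ≻ L₁ H₁ + L₂ H₂`. -/
lemma exists_posSemidef_of_not_lmi {k m : Type*} [DecidableEq k] [Fintype m] [DecidableEq m]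
    (L₁ L₂ : Matrix k k ℂ →ₗ[ℝ] Matrix m m ℂ)
    (hL₁ : ∀ H, H.IsHermitian → (L₁ H).IsHermitian)
    (hL₂ : ∀ H, H.IsHermitian → (L₂ H).IsHermitian)
    {G : Matrix m m ℂ} (hG : G.IsHermitian)
    (hno : ¬∃ H₁ H₂ : Matrix k k ℂ, H₁.IsHermitian ∧ H₂.PosDef ∧
      (G - (L₁ H₁ + L₂ H₂)).PosDef) :
    ∃ X : Matrix m m ℂ, X.PosSemidef ∧ X ≠ 0 ∧ (X * G).trace.re ≤ 0 ∧
      (∀ H, H.IsHermitian → (X * L₁ H).trace.re = 0) ∧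
      ∀ H, H.PosSemidef → 0 ≤ (X * L₂ H).trace.re := by
  let U : Set (Matrix m m ℂ) := {Y | ∃ H₁ H₂ : Matrix k k ℂ, H₁.IsHermitian ∧ H₂.PosDef ∧
    ∀ x : m → ℂ, x ≠ 0 → 0 < (star x ⬝ᵥ (Y - (L₁ H₁ + L₂ H₂)) *ᵥ x).re}
  have hquad_smul : ∀ (c : ℝ) (Y : Matrix m m ℂ) (x : m → ℂ),
      (star x ⬝ᵥ (c • Y) *ᵥ x).re = c * (star x ⬝ᵥ Y *ᵥ x).re := fun c Y x => by
    rw [smul_mulVec, dotProduct_smul, Complex.smul_re, smul_eq_mul]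
  have hUsmul : ∀ (c : ℝ) (Y : Matrix m m ℂ), 0 < c → Y ∈ U → c • Y ∈ U := by
    rintro c Y hc ⟨H₁, H₂, h₁, h₂, h⟩
    refine ⟨c • H₁, c • H₂, h₁.smul (IsSelfAdjoint.all c), h₂.smul hc, fun x hx => ?_⟩
    rw [map_smul, map_smul, ← smul_add, ← smul_sub, hquad_smul]
    exact mul_pos hc (h x hx)
  have hUadd : ∀ Y Y' : Matrix m m ℂ, Y ∈ U → Y' ∈ U → Y + Y' ∈ U := by
    rintro Y Y' ⟨H₁, H₂, h₁, h₂, h⟩ ⟨H₁', H₂', h₁', h₂', h'⟩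
    refine ⟨H₁ + H₁', H₂ + H₂', h₁.add h₁', h₂.add h₂', fun x hx => ?_⟩
    have hsplit : Y + Y' - (L₁ (H₁ + H₁') + L₂ (H₂ + H₂')) =
        (Y - (L₁ H₁ + L₂ H₂)) + (Y' - (L₁ H₁' + L₂ H₂')) := by
      rw [map_add, map_add]
      abel
    rw [hsplit, add_mulVec, dotProduct_add, Complex.add_re]
    exact add_pos (h x hx) (h' x hx)
  have hUconv : Convex ℝ U := convex_iff_forall_pos.2 fun Y hY Y' hY' a b ha hb _ =>
    hUadd _ _ (hUsmul a Y ha hY) (hUsmul b Y' hb hY')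
  have hUopen : IsOpen U := by
    refine isOpen_iff_mem_nhds.2 ?_
    rintro Y ⟨H₁, H₂, h₁, h₂, h⟩
    have hcont : Continuous fun Y' : Matrix m m ℂ => Y' - (L₁ H₁ + L₂ H₂) := by fun_prop
    exact Filter.mem_of_superset
      ((isOpen_setOf_forall_re_dotProduct_mulVec_pos.preimage hcont).mem_nhds h)
      fun Y' h' => ⟨H₁, H₂, h₁, h₂, h'⟩
  have hGU : G ∉ U := by
    rintro ⟨H₁, H₂, h₁, h₂, h⟩
    have hherm := hG.sub ((hL₁ H₁ h₁).add (hL₂ H₂ h₂.isHermitian))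
    exact hno ⟨H₁, H₂, h₁, h₂, PosDef.of_dotProduct_mulVec_pos hherm fun x hx =>
      Complex.pos_iff.2 ⟨h x hx, (hherm.im_star_dotProduct_mulVec_self x).symm⟩⟩
  obtain ⟨f, hf⟩ := geometric_hahn_banach_open_point hUconv hUopen hGU
  let g : Matrix m m ℂ →ₗ[ℝ] ℝ := -f.toLinearMap
  have hg : ∀ Y ∈ U, g G < g Y := fun Y hY => neg_lt_neg (hf Y hY)
  have hgU : ∀ Y ∈ U, 0 ≤ g Y := by
    intro Y hY
    by_contra! hlt
    have h := hg _ (hUsmul ((|g G| + 1) / -g Y) Y (by have := neg_pos.2 hlt; positivity) hY)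
    rw [map_smul, smul_eq_mul, div_neg, neg_mul, div_mul_cancel₀ _ hlt.ne] at h
    linarith [neg_abs_le (g G)]
  have hmem : ∀ (H₁ H₂ : Matrix k k ℂ) (P : Matrix m m ℂ), H₁.IsHermitian → H₂.PosDef →
      P.PosDef → L₁ H₁ + L₂ H₂ + P ∈ U := fun H₁ H₂ P h₁ h₂ hP =>
    ⟨H₁, H₂, h₁, h₂, fun x hx => by
      rw [add_sub_cancel_left]
      exact (Complex.pos_iff.1 (hP.dotProduct_mulVec_pos hx)).1⟩
  let E₀ : Matrix m m ℂ := L₂ 1 + 1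
  have hE₀ : E₀ ∈ U := by
    simpa [E₀] using hmem 0 1 1 isHermitian_zero PosDef.one PosDef.one
  have hcone : ∀ (H₁ H₂ : Matrix k k ℂ) (P : Matrix m m ℂ), H₁.IsHermitian → H₂.PosSemidef →
      P.PosSemidef → 0 ≤ g (L₁ H₁ + L₂ H₂ + P) := by
    intro H₁ H₂ P h₁ h₂ hP
    by_contra! hlt
    have hE := hgU _ hE₀
    set Y := L₁ H₁ + L₂ H₂ + P with hY
    have hε : 0 < -g Y / (g E₀ + 1) := div_pos (neg_pos.2 hlt) (by linarith)
    have hεE : -g Y / (g E₀ + 1) * (g E₀ + 1) = -g Y := div_mul_cancel₀ _ (by linarith)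
    set ε := -g Y / (g E₀ + 1)
    have h := hgU _ (hmem H₁ (H₂ + ε • 1) (P + ε • 1) h₁
      (PosDef.posSemidef_add h₂ (PosDef.one.smul hε))
      (PosDef.posSemidef_add hP (PosDef.one.smul hε)))
    have hsplit : L₁ H₁ + L₂ (H₂ + ε • 1) + (P + ε • 1) = Y + ε • E₀ := by
      rw [map_add, map_smul, hY, smul_add]
      abel
    rw [hsplit, map_add, map_smul, smul_eq_mul] at h
    linarith
  have hgG : g G ≤ 0 := by
    by_contra! hlt
    have hE := hgU _ hE₀
    have hc : 0 < g G / (g E₀ + 1) := div_pos hlt (by linarith)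
    have hcE : g G / (g E₀ + 1) * (g E₀ + 1) = g G := div_mul_cancel₀ _ (by linarith)
    have h := hg _ (hUsmul _ _ hc hE₀)
    rw [map_smul, smul_eq_mul] at h
    linarith
  obtain ⟨X', hX'⟩ := exists_eq_re_trace_mul g
  have hXg : ∀ Y : Matrix m m ℂ, Y.IsHermitian → ((X' + X'ᴴ) * Y).trace.re = 2 * g Y := by
    intro Y hY
    have h1 : (X'ᴴ * Y).trace.re = g Y := by
      rw [hX', ← Complex.conj_re, ← RCLike.star_def, ← trace_conjTranspose, conjTranspose_mul,
        conjTranspose_conjTranspose, hY.eq, trace_mul_comm]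
    rw [Matrix.add_mul, trace_add, Complex.add_re, h1, ← hX']
    ring
  have hXherm : (X' + X'ᴴ).IsHermitian := isHermitian_add_transpose_self X'
  refine ⟨X' + X'ᴴ, PosSemidef.of_dotProduct_mulVec_nonneg hXherm fun x => ?_, fun h => ?_, ?_,
    fun H hH => ?_, fun H hH => ?_⟩
  · refine Complex.nonneg_iff.2 ⟨?_, (hXherm.im_star_dotProduct_mulVec_self x).symm⟩
    have hpsd : (vecMulVec x (star x)).PosSemidef := posSemidef_vecMulVec_self_star x
    have h1 := hcone 0 0 _ isHermitian_zero PosSemidef.zero hpsd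
    rw [map_zero, map_zero, add_zero, zero_add] at h1
    have h2 := hXg _ hpsd.isHermitian
    rw [mul_vecMulVec, trace_vecMulVec, dotProduct_comm] at h2
    linarith
  · have h1 := hXg _ hG
    have h2 := hXg _ ((hL₂ 1 isHermitian_one).add isHermitian_one)
    rw [h, Matrix.zero_mul, trace_zero, Complex.zero_re] at h1 h2
    have h3 : g G < g (L₂ 1 + 1) := hg _ hE₀
    linarith
  · linarith [hXg _ hG]
  · have h1 := hcone H 0 0 hH PosSemidef.zero PosSemidef.zero
    have h2 := hcone (-H) 0 0 hH.neg PosSemidef.zero PosSemidef.zero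
    rw [map_zero, add_zero, add_zero] at h1 h2
    rw [map_neg, map_neg] at h2
    rw [hXg _ (hL₁ H hH)]
    linarith
  · have h1 := hcone 0 H 0 isHermitian_zero hH PosSemidef.zero
    rw [map_zero, add_zero, zero_add] at h1
    rw [hXg _ (hL₂ H hH.isHermitian)]
    linarith

lemma lyapAdj_isHermitian {k m : Type*} [Fintype k] (M N : Matrix k m ℂ)
    {Θ : Matrix (Fin 2) (Fin 2) ℂ}
    (hΘ : Θ.IsHermitian) {H : Matrix k k ℂ} (hH : H.IsHermitian) :
    (lyapAdj M N Θ H).IsHermitian := by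
  simp only [lyapAdj, IsHermitian, conjTranspose_add, conjTranspose_smul, conjTranspose_mul,
    conjTranspose_conjTranspose, hH.eq, hΘ.apply, Matrix.mul_assoc]
  abel

/-- `lyapAdj` as a real linear map. -/
noncomputable def lyapAdjLinearMap {k m : Type*} [Fintype k] (M N : Matrix k m ℂ)
    (Θ : Matrix (Fin 2) (Fin 2) ℂ) :
    Matrix k k ℂ →ₗ[ℝ] Matrix m m ℂ where
  toFun := lyapAdj M N Θ
  map_add' H H' := by
    simp only [lyapAdj, Matrix.mul_add, Matrix.add_mul, smul_add]
    abel
  map_smul' c H := by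
    simp only [lyapAdj, Matrix.mul_smul, Matrix.smul_mul, smul_add, smul_comm c, RingHom.id_apply]

lemma lyapAdj_congr {k m : Type*} [Fintype k] (S R : Matrix k m ℂ) (T Θ : Matrix (Fin 2) (Fin 2) ℂ)
    (H : Matrix k k ℂ) :
    lyapAdj (T 0 0 • S + T 1 0 • R) (T 0 1 • S + T 1 1 • R) Θ H =
      lyapAdj S R (T * Θ * Tᴴ) H := by
  simp only [lyapAdj, conjTranspose_add, conjTranspose_smul, Matrix.add_mul, Matrix.mul_add,
    Matrix.mul_smul, Matrix.smul_mul, smul_add, smul_smul, Matrix.mul_apply, Fin.sum_univ_two,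
    conjTranspose_apply]
  module

lemma dotProduct_lyapAdj_mulVec {k m : Type*} [Fintype k] [Fintype m] (M N : Matrix k m ℂ)
    (Θ : Matrix (Fin 2) (Fin 2) ℂ)
    (H : Matrix k k ℂ) {α β : ℂ} {z : m → ℂ} {v : k → ℂ} (hM : M *ᵥ z = α • v)
    (hN : N *ᵥ z = β • v) :
    star z ⬝ᵥ lyapAdj M N Θ H *ᵥ z = hermPairVal Θ α β * (star v ⬝ᵥ H *ᵥ v) := by
  have key : ∀ (A B : Matrix k m ℂ) (a b : ℂ), A *ᵥ z = a • v → B *ᵥ z = b • v →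
      star z ⬝ᵥ (Aᴴ * H * B) *ᵥ z = star a * b * (star v ⬝ᵥ H *ᵥ v) := by
    intro A B a b hA hB
    rw [Matrix.mul_assoc, ← mulVec_mulVec, ← mulVec_mulVec, dotProduct_mulVec, ← star_mulVec, hA,
      hB, mulVec_smul, star_smul, smul_dotProduct, dotProduct_smul]
    simp only [smul_eq_mul]
    ring
  simp only [lyapAdj, add_mulVec, smul_mulVec, dotProduct_add, dotProduct_smul, smul_eq_mul,
    key M M α α hM hM, key M N α β hM hN, key N M β α hN hM, key N N β β hN hN, hermPairVal_eq]
  ring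

lemma exists_eq_smul_of_smul_eq {k : Type*} {α β : ℂ} (h : ¬(α = 0 ∧ β = 0)) {x y : k → ℂ}
    (hxy : α • y = β • x) : ∃ v, x = α • v ∧ y = β • v := by
  by_cases hβ : β = 0
  · have hα : α ≠ 0 := fun hα => h ⟨hα, hβ⟩
    refine ⟨α⁻¹ • x, by rw [smul_inv_smul₀ hα], ?_⟩
    rw [hβ, zero_smul] at hxy ⊢
    exact (smul_eq_zero.1 hxy).resolve_left hα
  · exact ⟨β⁻¹ • y, by rw [smul_comm, hxy, inv_smul_smul₀ hβ], by rw [smul_inv_smul₀ hβ]⟩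

/-- The linear matrix inequality for a pair in normal form. -/
lemma exists_lmi_of_isNormalPair {k m : Type*} [Fintype k] [DecidableEq k] [Fintype m]
    [DecidableEq m] {pos : Prop} {κ : ℝ} {Θ₁ Θ₂ : Matrix (Fin 2) (Fin 2) ℂ}
    (hΘ₁ : Θ₁.IsHermitian) (hΘ₂ : Θ₂.IsHermitian) (hnf : IsNormalPair pos κ Θ₁ Θ₂)
    (S R : Matrix k m ℂ) {G : Matrix m m ℂ} (hG : G.IsHermitian)
    (hfreq : ∀ s t : ℝ, ¬(s = 0 ∧ t = 0) → (pos → 0 ≤ s * t) → ∀ z : m → ℂ, z ≠ 0 →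
      (s : ℂ) • R *ᵥ z = (t : ℂ) • S *ᵥ z → 0 < (star z ⬝ᵥ G *ᵥ z).re) :
    ∃ H₁ H₂ : Matrix k k ℂ, H₁.IsHermitian ∧ H₂.PosDef ∧
      (G - (lyapAdj S R Θ₁ H₁ + lyapAdj S R Θ₂ H₂)).PosDef := by
  by_contra hno
  obtain ⟨X, hX, hX0, hXG, h₁, h₂⟩ := exists_posSemidef_of_not_lmi
    (lyapAdjLinearMap S R Θ₁) (lyapAdjLinearMap S R Θ₂)
    (fun H hH => lyapAdj_isHermitian S R hΘ₁ hH) (fun H hH => lyapAdj_isHermitian S R hΘ₂ hH)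
    hG hno
  obtain ⟨hκ, rfl, a, d, b, rfl, hb⟩ := hnf
  have hconj : ∀ x, star x ⬝ᵥ (R * X * Sᴴ) *ᵥ x = star (star x ⬝ᵥ (S * X * Rᴴ) *ᵥ x) := by
    intro x
    rw [← star_dotProduct, star_mulVec, ← dotProduct_mulVec]
    simp [conjTranspose_mul, Matrix.mul_assoc, hX.isHermitian.eq]
  have him : ∀ x, (star x ⬝ᵥ (S * X * Rᴴ) *ᵥ x).im = 0 := by
    intro x
    have h := h₁ _ (posSemidef_vecMulVec_self_star x).isHermitian
    simp only [lyapAdjLinearMap, LinearMap.coe_mk, AddHom.coe_mk, lyapAdj, Matrix.mul_add,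
      Matrix.mul_smul, trace_add, trace_smul, trace_mul_vecMulVec_star, hconj] at h
    simp at h
    exact h.resolve_left hκ
  have hherm : (S * X * Rᴴ).IsHermitian := by
    rw [← isSymmetric_toEuclideanLin_iff, LinearMap.isSymmetric_iff_inner_map_self_real]
    intro v
    rw [Complex.conj_eq_iff_im]
    have h := him v.ofLp
    rw [← neg_eq_zero, ← Complex.conj_im, ← RCLike.star_def, ← star_dotProduct] at h
    rw [EuclideanSpace.inner_eq_star_dotProduct]
    simpa [dotProduct_comm, Matrix.mul_assoc] using h
  have hpos : pos → (S * X * Rᴴ).PosSemidef := by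
    intro hp
    obtain ⟨_, rfl, rfl, hb0⟩ := hb.resolve_left fun h => h.1 hp
    refine PosSemidef.of_dotProduct_mulVec_nonneg hherm fun x =>
      Complex.nonneg_iff.2 ⟨?_, (him x).symm⟩
    have h := h₂ _ (posSemidef_vecMulVec_self_star x)
    simp only [lyapAdjLinearMap, LinearMap.coe_mk, AddHom.coe_mk, lyapAdj, Matrix.mul_add,
      Matrix.mul_smul, trace_add, trace_smul, trace_mul_vecMulVec_star, hconj] at h
    simp [him x] at h
    have h' : 0 ≤ b.re * (star x ⬝ᵥ (S * X * Rᴴ) *ᵥ x).re := by linarith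
    exact nonneg_of_mul_nonneg_right h' hb0
  obtain ⟨Y, rfl⟩ : ∃ Y : Matrix m m ℂ, X = Yᴴ * Y := by
    open scoped MatrixOrder in
    exact CStarAlgebra.nonneg_iff_eq_star_mul_self.mp hX.nonneg
  have hfac : S * Yᴴ * (R * Yᴴ)ᴴ = S * (Yᴴ * Y) * Rᴴ := by
    simp only [conjTranspose_mul, conjTranspose_conjTranspose, Matrix.mul_assoc]
  have htr := trace_pos_of_pencil pos S R G hfreq Yᴴ
    (fun h => hX0 (by rw [h, Matrix.zero_mul])) (by rwa [hfac]) (by rwa [hfac])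
  rw [Matrix.mul_assoc, trace_mul_comm, Matrix.mul_assoc, conjTranspose_conjTranspose,
    trace_mul_comm] at htr
  exact hXG.not_gt htr

/-- **Generalized Yakubovich Lemma (Iwasaki–Hara, 2005).**
Provided `Γ_{Θ₁} ∩ Ω_{Θ₂}` contains more than one point and `n_z > n`, the strict
frequency-domain inequality `z*Gz > 0` on `Γ_{Θ₁} ∩ Ω_{Θ₂}` is equivalent to the LMI
`G ≻ Λ'_{M,N,Θ₁}(H₁) + Λ'_{M,N,Θ₂}(H₂)` for some Hermitian `H₁, H₂` with `H₂ ≻ 0`. -/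
theorem generalized_yakubovich_lemma
    (n nz : ℕ) (hnz : n < nz)
    (M N : Matrix (Fin n) (Fin nz) ℂ)
    (G : Matrix (Fin nz) (Fin nz) ℂ) (hG : G.IsHermitian)
    (Θ₁ Θ₂ : Matrix (Fin 2) (Fin 2) ℂ)
    (hΘ₁herm : Θ₁.IsHermitian) (hΘ₂herm : Θ₂.IsHermitian)
    (hΘ₁det : Θ₁.det.re < 0) (hΘ₂det : Θ₂.det.re < 0)
    (htwo : ∃ α₁ β₁ α₂ β₂ : ℂ, ¬(α₁ = 0 ∧ β₁ = 0) ∧ ¬(α₂ = 0 ∧ β₂ = 0) ∧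
      (∀ c : ℂ, ¬(α₂ = c * α₁ ∧ β₂ = c * β₁)) ∧
      hermPairVal Θ₁ α₁ β₁ = 0 ∧ 0 ≤ (hermPairVal Θ₂ α₁ β₁).re ∧
      hermPairVal Θ₁ α₂ β₂ = 0 ∧ 0 ≤ (hermPairVal Θ₂ α₂ β₂).re) :
    (∀ α β : ℂ, ¬(α = 0 ∧ β = 0) →
        hermPairVal Θ₁ α β = 0 → 0 ≤ (hermPairVal Θ₂ α β).re →
        ∀ z : Fin nz → ℂ, z ≠ 0 → (α • N - β • M) *ᵥ z = 0 →
          0 < (star z ⬝ᵥ G *ᵥ z).re)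
      ↔
    (∃ H₁ H₂ : Matrix (Fin n) (Fin n) ℂ, H₁.IsHermitian ∧ H₂.IsHermitian ∧
        H₂.PosDef ∧ (G - (lyapAdj M N Θ₁ H₁ + lyapAdj M N Θ₂ H₂)).PosDef) := by
  refine ⟨fun hfreq => ?_, ?_⟩
  · obtain ⟨α₁, β₁, α₂, β₂, hp₁, -, hc, h₁₁, h₂₁, h₁₂, h₂₂⟩ := htwo
    have hind : α₁ * β₂ - β₁ * α₂ ≠ 0 := by
      intro h
      by_cases hα : α₁ = 0
      · have hβ : β₁ ≠ 0 := fun hβ => hp₁ ⟨hα, hβ⟩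
        refine hc (β₂ / β₁) ⟨?_, by field_simp⟩
        field_simp
        linear_combination -h
      · refine hc (α₂ / α₁) ⟨by field_simp, ?_⟩
        field_simp
        linear_combination h
    have hdet : Θ₁.det ≠ 0 := fun h => by simp [h] at hΘ₁det
    obtain ⟨T, pos, κ, hT, hnf⟩ :=
      exists_isNormalPair hΘ₁herm hΘ₂herm hdet hind h₁₁ h₂₁ h₁₂ h₂₂
    obtain ⟨S, R, hM, hN⟩ : ∃ S R : Matrix (Fin n) (Fin nz) ℂ,
        T 0 0 • S + T 1 0 • R = M ∧ T 0 1 • S + T 1 1 • R = N := by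
      have hinv : T.det⁻¹ * (T 0 0 * T 1 1 - T 0 1 * T 1 0) = 1 := by
        rw [← det_fin_two, inv_mul_cancel₀ hT]
      refine ⟨T.det⁻¹ • (T 1 1 • M - T 1 0 • N), T.det⁻¹ • (T 0 0 • N - T 0 1 • M), ?_, ?_⟩
      · refine Eq.trans ?_ (one_smul ℂ M)
        rw [← hinv]
        module
      · refine Eq.trans ?_ (one_smul ℂ N)
        rw [← hinv]
        module
    obtain ⟨H₁, H₂, hH₁, hH₂, hlmi⟩ := exists_lmi_of_isNormalPair
      (isHermitian_mul_mul_conjTranspose T hΘ₁herm) (isHermitian_mul_mul_conjTranspose T hΘ₂herm)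
      hnf S R hG (by
        intro s t hst hpos z hz hker
        obtain ⟨hκ, hΘ₁eq, a, d, b, hΘ₂eq, hb⟩ := hnf
        refine hfreq (s * T 0 0 + t * T 1 0) (s * T 0 1 + t * T 1 1) ?_ ?_ ?_ z hz ?_
        · rintro ⟨h1, h2⟩
          have hs : (s : ℂ) * T.det = 0 := by
            rw [det_fin_two]
            linear_combination T 1 1 * h1 - T 1 0 * h2
          have ht : (t : ℂ) * T.det = 0 := by
            rw [det_fin_two]
            linear_combination T 0 0 * h2 - T 0 1 * h1
          exact hst ⟨by simpa [hT] using hs, by simpa [hT] using ht⟩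
        · rw [← hermPairVal_congr, hΘ₁eq, hermPairVal_eq]
          simp
          ring
        · rw [← hermPairVal_congr, hΘ₂eq, hermPairVal_eq]
          have hre : s * a * s + s * b.re * t + t * b.re * s + t * d * t ≥ 0 := by
            rcases hb with ⟨_, ha, hd, hle⟩ | ⟨hp, rfl, rfl, hb0⟩
            · rcases ha.eq_or_lt with rfl | ha
              · have hb : b.re = 0 := by nlinarith
                rw [hb]
                linarith [mul_nonneg hd (sq_nonneg t)]
              · refine nonneg_of_mul_nonneg_right ?_ ha
                linarith [sq_nonneg (a * s + b.re * t),
                  mul_nonneg (sub_nonneg.2 hle) (sq_nonneg t)]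
            · nlinarith [mul_nonneg hb0.le (hpos hp)]
          simpa using hre
        · have h : (s * T 0 0 + t * T 1 0) • N - (s * T 0 1 + t * T 1 1) • M =
              T.det • ((s : ℂ) • R - (t : ℂ) • S) := by
            nth_rw 1 [← hM, ← hN]
            rw [det_fin_two]
            module
          rw [h, smul_mulVec, sub_mulVec, smul_mulVec, smul_mulVec, hker, sub_self, smul_zero])
    rw [← lyapAdj_congr, ← lyapAdj_congr, hM, hN] at hlmi
    exact ⟨H₁, H₂, hH₁, hH₂.isHermitian, hH₂, hlmi⟩
  · rintro ⟨H₁, H₂, -, -, hH₂, hlmi⟩ α β hαβ h₁ h₂ z hz hker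
    rw [sub_mulVec, smul_mulVec, smul_mulVec, sub_eq_zero] at hker
    obtain ⟨v, hMv, hNv⟩ := exists_eq_smul_of_smul_eq hαβ hker
    have hpos := (Complex.pos_iff.1 (hlmi.dotProduct_mulVec_pos hz)).1
    rw [sub_mulVec, add_mulVec, dotProduct_sub, dotProduct_add,
      dotProduct_lyapAdj_mulVec M N Θ₁ H₁ hMv hNv, dotProduct_lyapAdj_mulVec M N Θ₂ H₂ hMv hNv,
      h₁, zero_mul, zero_add, ← hermPairVal_re_eq Θ₂ hΘ₂herm, Complex.sub_re,
      Complex.re_ofReal_mul] at hpos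
    have hv := (Complex.nonneg_iff.1 (hH₂.posSemidef.dotProduct_mulVec_nonneg v)).1
    linarith [mul_nonneg h₂ hv]
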